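/- arXiv:1407.3642 — 4 statements merged into one kernel-verified Lean document; each statement's English description precedes it below -/
import Mathlib

section
/- For all indices i, j ∈ {1,…,N}, the matrices A_k satisfy the adjoint-representation relation A_i·A_j − A_j·A_i = Σ_{k=1}^{N} (A_i)_{k,j} · A_k, where (A_i)_{k,j} denotes the (k,j) entry of A_i. -/
open Matrix

/-- `T k = n(k)•𝟙 − eₖᵀ·n`, where `eₖᵀ·n` is the rank-one matrix with `(i,j)` entry
`eₖ(i)·n(j)`. -/
def Tmat {𝕜 : Type*} [RCLike 𝕜] {N : ℕ} (n : Fin N → 𝕜) (k : Fin N) :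
    Matrix (Fin N) (Fin N) 𝕜 :=
  n k • (1 : Matrix (Fin N) (Fin N) 𝕜) - Matrix.vecMulVec (Pi.single k 1) n

/-- `A k = P·(T k)`. -/
def Amat {𝕜 : Type*} [RCLike 𝕜] {N : ℕ} (P : Matrix (Fin N) (Fin N) 𝕜)
    (n : Fin N → 𝕜) (k : Fin N) : Matrix (Fin N) (Fin N) 𝕜 :=
  P * Tmat n k

theorem mul_Tmat_apply {𝕜 : Type*} [RCLike 𝕜] {N : ℕ} (M : Matrix (Fin N) (Fin N) 𝕜)
    (n : Fin N → 𝕜) (k a b : Fin N) :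
    (M * Tmat n k) a b = n k * M a b - M a k * n b := by
  simp [Tmat, Matrix.mul_sub, Matrix.mul_vecMulVec, Matrix.vecMulVec_apply]

theorem Amat_mul {𝕜 : Type*} [RCLike 𝕜] {N : ℕ} {P : Matrix (Fin N) (Fin N) 𝕜}
    {n : Fin N → 𝕜} (hn : Matrix.vecMul n P = 0) (i : Fin N) :
    Amat P n i * P = n i • (P * P) := by
  simp [Amat, Tmat, Matrix.mul_sub, Matrix.sub_mul, Matrix.mul_assoc, Matrix.vecMulVec_mul, hn]

theorem Amat_mul_Amat_apply {𝕜 : Type*} [RCLike 𝕜] {N : ℕ} {P : Matrix (Fin N) (Fin N) 𝕜}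
    {n : Fin N → 𝕜} (hn : Matrix.vecMul n P = 0) (i j a b : Fin N) :
    (Amat P n i * Amat P n j) a b = n i * (n j * (P * P) a b - (P * P) a j * n b) := by
  rw [Amat.eq_1 P n j, ← Matrix.mul_assoc, Amat_mul hn, mul_Tmat_apply]
  simp only [Matrix.smul_apply, smul_eq_mul]
  ring

theorem sum_smul_Amat_apply {𝕜 : Type*} [RCLike 𝕜] {N : ℕ} (P : Matrix (Fin N) (Fin N) 𝕜)
    (n v : Fin N → 𝕜) (a b : Fin N) :
    (∑ k, v k • Amat P n k) a b = (n ⬝ᵥ v) * P a b - (P *ᵥ v) a * n b := by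
  simp only [Amat, Matrix.sum_apply, Matrix.smul_apply, smul_eq_mul, mul_Tmat_apply,
    dotProduct, Matrix.mulVec, Finset.sum_mul, ← Finset.sum_sub_distrib]
  exact Finset.sum_congr rfl fun k _ => by ring

/-- The matrices `A k` satisfy the adjoint-representation relation
`A i * A j − A j * A i = ∑ k, (A i)ₖⱼ • A k`. -/
theorem stmt0 {𝕜 : Type*} [RCLike 𝕜] {N : ℕ} (P : Matrix (Fin N) (Fin N) 𝕜)
    (n : Fin N → 𝕜) (hn : Matrix.vecMul n P = 0) (i j : Fin N) :
    Amat P n i * Amat P n j - Amat P n j * Amat P n i =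
      ∑ k : Fin N, Amat P n i k j • Amat P n k := by
  have hA : Matrix.vecMul n (Amat P n i) = 0 := by
    rw [Amat, ← Matrix.vecMul_vecMul, hn, Matrix.zero_vecMul]
  have hnv : n ⬝ᵥ (fun k => Amat P n i k j) = 0 := congrFun hA j
  have hPv : ∀ a, (P *ᵥ fun k => Amat P n i k j) a = n i * (P * P) a j - (P * P) a i * n j := by
    intro a
    rw [← mul_Tmat_apply, Matrix.mul_assoc]
    rfl
  ext a b
  rw [sum_smul_Amat_apply P n (fun k => Amat P n i k j), hnv, hPv, Matrix.sub_apply,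
    Amat_mul_Amat_apply hn, Amat_mul_Amat_apply hn]
  ring
end

section
/- For all indices i, j, k, l ∈ {1,…,N}, the double commutator vanishes: [[A_i, A_j], [A_k, A_l]] = 0, where [X,Y] = X·Y − Y·X denotes the matrix commutator. -/
open Matrix

theorem vecMulVec_mul_eq_zero {𝕜 : Type*} [RCLike 𝕜] {N : ℕ} {P : Matrix (Fin N) (Fin N) 𝕜}
    {n : Fin N → 𝕜} (hn : Matrix.vecMul n P = 0) (v : Fin N → 𝕜) :
    Matrix.vecMulVec v n * P = 0 := by
  rw [Matrix.vecMulVec_mul, hn, Matrix.vecMulVec_zero]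

theorem Amat_mul_Amat {𝕜 : Type*} [RCLike 𝕜] {N : ℕ} {P : Matrix (Fin N) (Fin N) 𝕜}
    {n : Fin N → 𝕜} (hn : Matrix.vecMul n P = 0) (i j : Fin N) :
    Amat P n i * Amat P n j =
      (n i * n j) • (P * P) - P * P * Matrix.vecMulVec (n i • Pi.single j 1) n := by
  have hT : Tmat n i * P = n i • P := by
    simp [Tmat, Matrix.sub_mul, vecMulVec_mul_eq_zero hn]
  calc Amat P n i * Amat P n j = P * (Tmat n i * P) * Tmat n j := by
        simp only [Amat, Matrix.mul_assoc]
    _ = _ := by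
        rw [hT, Tmat, Matrix.smul_vecMulVec]
        simp [Matrix.mul_sub, smul_sub, smul_smul]

/-- The commutator of `A i` and `A j` has the form `P²·uᵀ·n`. -/
theorem Amat_commutator {𝕜 : Type*} [RCLike 𝕜] {N : ℕ} {P : Matrix (Fin N) (Fin N) 𝕜}
    {n : Fin N → 𝕜} (hn : Matrix.vecMul n P = 0) (i j : Fin N) :
    Amat P n i * Amat P n j - Amat P n j * Amat P n i =
      P * P * Matrix.vecMulVec (n j • Pi.single i 1 - n i • Pi.single j 1) n := by
  rw [Amat_mul_Amat hn, Amat_mul_Amat hn, Matrix.sub_vecMulVec, Matrix.mul_sub, mul_comm (n j)]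
  abel

theorem mul_vecMulVec_mul_mul_vecMulVec_eq_zero {𝕜 : Type*} [RCLike 𝕜] {N : ℕ}
    {P : Matrix (Fin N) (Fin N) 𝕜} {n : Fin N → 𝕜} (hn : Matrix.vecMul n P = 0)
    (u v : Fin N → 𝕜) :
    P * P * Matrix.vecMulVec u n * (P * P * Matrix.vecMulVec v n) = 0 := by
  calc P * P * Matrix.vecMulVec u n * (P * P * Matrix.vecMulVec v n)
      = P * P * (Matrix.vecMulVec u n * P) * (P * Matrix.vecMulVec v n) := by
        simp only [Matrix.mul_assoc]
    _ = 0 := by rw [vecMulVec_mul_eq_zero hn, Matrix.mul_zero, Matrix.zero_mul]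

/-- The double commutator `[[A i, A j], [A k, A l]]` vanishes. -/
theorem stmt2 {𝕜 : Type*} [RCLike 𝕜] {N : ℕ} (P : Matrix (Fin N) (Fin N) 𝕜)
    (n : Fin N → 𝕜) (hn : Matrix.vecMul n P = 0) (i j k l : Fin N) :
    (Amat P n i * Amat P n j - Amat P n j * Amat P n i) *
        (Amat P n k * Amat P n l - Amat P n l * Amat P n k) -
      (Amat P n k * Amat P n l - Amat P n l * Amat P n k) *
        (Amat P n i * Amat P n j - Amat P n j * Amat P n i) = 0 := by
  rw [Amat_commutator hn, Amat_commutator hn, mul_vecMulVec_mul_mul_vecMulVec_eq_zero hn,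
    mul_vecMulVec_mul_mul_vecMulVec_eq_zero hn, sub_zero]
end

section
/- For all indices i, j, k ∈ {1,…,N}, the trace Tr( A_i · (A_j·A_k − A_k·A_j) ) = 0; that is, the Killing-type form of any A_i against any commutator of the A's vanishes. -/
open Matrix

theorem Tmat_mul_of_vecMul_eq_zero {𝕜 : Type*} [RCLike 𝕜] {N : ℕ} {P : Matrix (Fin N) (Fin N) 𝕜}
    {n : Fin N → 𝕜} (hn : Matrix.vecMul n P = 0) (k : Fin N) : Tmat n k * P = n k • P := by
  simp [Tmat, sub_mul, Matrix.vecMulVec_mul, hn]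

theorem trace_Amat_mul_mul {𝕜 : Type*} [RCLike 𝕜] {N : ℕ} {P : Matrix (Fin N) (Fin N) 𝕜}
    {n : Fin N → 𝕜} (hn : Matrix.vecMul n P = 0) (i j k : Fin N) :
    Matrix.trace (Amat P n i * (Amat P n j * Amat P n k)) =
      n i * n j * n k * Matrix.trace (P * P * P) := by
  have hT := Tmat_mul_of_vecMul_eq_zero hn
  calc
    _ = Matrix.trace (P * (Tmat n i * P) * (Tmat n j * P) * Tmat n k) := by
      simp only [Amat, Matrix.mul_assoc]
    _ = Matrix.trace (Tmat n k * P * (Tmat n i * P) * (Tmat n j * P)) := by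
      rw [Matrix.trace_mul_comm]
      simp only [Matrix.mul_assoc]
    _ = _ := by
      simp only [hT, Matrix.smul_mul, Matrix.mul_smul, Matrix.trace_smul, smul_eq_mul]
      ring

/-- The Killing-type form of any `A i` against any commutator vanishes. -/
theorem stmt3 {𝕜 : Type*} [RCLike 𝕜] {N : ℕ} (P : Matrix (Fin N) (Fin N) 𝕜)
    (n : Fin N → 𝕜) (hn : Matrix.vecMul n P = 0) (i j k : Fin N) :
    Matrix.trace (Amat P n i * (Amat P n j * Amat P n k - Amat P n k * Amat P n j)) = 0 := by
  rw [mul_sub, Matrix.trace_sub, trace_Amat_mul_mul hn, trace_Amat_mul_mul hn]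
  ring
end

section
/- The structure constants f defined by f(i,j,k) = (A_i)_{k,j} (the (k,j) entry of A_i) satisfy the Jacobi identity in structure-constant form: for all i, j, k, m ∈ {1,…,N}, Σ_{l=1}^{N} [ f(i,j,l)·f(k,l,m) + f(k,i,l)·f(j,l,m) + f(j,k,l)·f(i,l,m) ] = 0. -/
open Matrix

theorem Amat_apply {𝕜 : Type*} [RCLike 𝕜] {N : ℕ} (P : Matrix (Fin N) (Fin N) 𝕜)
    (n : Fin N → 𝕜) (i k j : Fin N) : Amat P n i k j = n i * P k j - n j * P k i := by
  simp [Amat, Tmat, Matrix.mul_sub, Matrix.mul_vecMulVec, Matrix.vecMulVec_apply, mul_comm]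

/-- Contracting two structure constants `f(i,j,l) = (A i)ₗⱼ` over `l` only involves `P * P`
when `n` is a left null vector of `P`. -/
theorem sum_Amat_mul_Amat {𝕜 : Type*} [RCLike 𝕜] {N : ℕ} (P : Matrix (Fin N) (Fin N) 𝕜)
    (n : Fin N → 𝕜) (hn : Matrix.vecMul n P = 0) (i j k m : Fin N) :
    ∑ l, Amat P n i l j * Amat P n k m l =
      n k * (n i * (P * P) m j - n j * (P * P) m i) := by
  have hnull (a : Fin N) : ∑ l, n l * P l a = 0 := congrFun hn a
  calc
    _ = ∑ l, (n k * n i * (P m l * P l j) - n k * n j * (P m l * P l i)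
          - P m k * n i * (n l * P l j) + P m k * n j * (n l * P l i)) :=
      Finset.sum_congr rfl fun l _ => by simp only [Amat_apply]; ring
    _ = _ := by
      simp only [Finset.sum_add_distrib, Finset.sum_sub_distrib, ← Finset.mul_sum, hnull,
        Matrix.mul_apply]
      ring

/-- The structure constants `f(i,j,k) = (A i)ₖⱼ` satisfy the Jacobi identity in
structure-constant form. -/
theorem stmt15 {𝕜 : Type*} [RCLike 𝕜] {N : ℕ} (P : Matrix (Fin N) (Fin N) 𝕜)
    (n : Fin N → 𝕜) (hn : Matrix.vecMul n P = 0)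
    (f : Fin N → Fin N → Fin N → 𝕜) (hf : ∀ i j k, f i j k = Amat P n i k j)
    (i j k m : Fin N) :
    ∑ l : Fin N, (f i j l * f k l m + f k i l * f j l m + f j k l * f i l m) = 0 := by
  simp only [hf, Finset.sum_add_distrib, sum_Amat_mul_Amat P n hn]
  ring
end
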